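/- Suppose Re s_k < 0 for k = 1, …, m, let ω ⊆ ℂ be open and star-shaped with respect to the origin, and let f be holomorphic on ω. Let {1,…,m} = S_1 ⊔ S_2 be a partition and set q_1(s) = ∏_{k∈S_1}(s − s_k), q_2(s) = ∏_{k∈S_2}(s − s_k), so that p = q_1 q_2. Then q_1(θ)(H_p f) = H_{q_2} f on ω, where H_{q_2} is defined using the roots (s_k)_{k∈S_2}. -/

import Mathlib

open MeasureTheory Polynomial

/-- The operator `H_p` associated with roots `s_1, …, s_m`:
`(H_p f)(t) = ∫_{[0,1]^m} (∏_k σ_k^{-s_k-1}) f(σ_1⋯σ_m t) dσ`. -/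
noncomputable def Hp {ι : Type*} [Fintype ι] (s : ι → ℂ) (f : ℂ → ℂ) (t : ℂ) : ℂ :=
  ∫ σ : ι → ℝ in Set.Icc 0 1,
    (∏ k, ((σ k : ℂ) ^ (-(s k) - 1))) * f ((∏ k, ((σ k : ℝ) : ℂ)) * t)

/-- The Euler operator `θu = t·u'(t)`. -/
noncomputable def eulerOp (u : ℂ → ℂ) : ℂ → ℂ := fun t => t * deriv u t

/-- For a polynomial `q(s) = ∑_j c_j s^j`, the operator `q(θ)u = ∑_j c_j θ^j u`. -/
noncomputable def polyEuler (q : Polynomial ℂ) (u : ℂ → ℂ) : ℂ → ℂ := fun t =>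
  ∑ j ∈ Finset.range (q.natDegree + 1), q.coeff j * (eulerOp^[j] u) t

open Set Filter Topology

/-- The operator `H_p` for the degree-one polynomial `p(s) = s - a`. -/
noncomputable def hOne (a : ℂ) (f : ℂ → ℂ) (t : ℂ) : ℂ :=
  ∫ x : ℝ in Icc 0 1, (x : ℂ) ^ (-a - 1) * f ((x : ℂ) * t)

lemma Hp_eq_integral_pi {ι : Type*} [Fintype ι] (s : ι → ℂ) (f : ℂ → ℂ) (t : ℂ) :
    Hp s f t = ∫ σ : ι → ℝ, (∏ k, ((σ k : ℂ) ^ (-(s k) - 1))) * f ((∏ k, ((σ k : ℝ) : ℂ)) * t)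
      ∂(Measure.pi fun _ => volume.restrict (Icc (0 : ℝ) 1)) := by
  rw [Hp, ← Measure.restrict_pi_pi, ← volume_pi, ← Set.pi_univ_Icc]
  rfl

lemma Hp_comp_equiv {ι κ : Type*} [Fintype ι] [Fintype κ] (e : ι ≃ κ) (s : κ → ℂ) (f : ℂ → ℂ)
    (t : ℂ) : Hp (fun i => s (e i)) f t = Hp s f t := by
  rw [Hp_eq_integral_pi, Hp_eq_integral_pi]
  rw [← (measurePreserving_piCongrLeft
    (fun _ : κ => volume.restrict (Icc (0 : ℝ) 1)) e).integral_comp']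
  refine integral_congr_ae (Eventually.of_forall fun σ => ?_)
  have h (i : ι) : MeasurableEquiv.piCongrLeft (fun _ : κ => ℝ) e σ (e i) = σ i := by
    exact Equiv.piCongrLeft_apply_apply (fun _ : κ => ℝ) e σ i
  simp only [← e.prod_comp, h]

lemma Hp_of_isEmpty {ι : Type*} [Fintype ι] [IsEmpty ι] (s : ι → ℂ) (f : ℂ → ℂ) (t : ℂ) :
    Hp s f t = f t := by
  rw [Hp_eq_integral_pi, Measure.pi_of_empty]
  simp

lemma integrable_cpow_Icc {a : ℂ} (ha : a.re < 0) :
    Integrable (fun x : ℝ => (x : ℂ) ^ (-a - 1)) (volume.restrict (Icc 0 1)) := by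
  have h := intervalIntegral.intervalIntegrable_cpow' (a := 0) (b := 1) (r := -a - 1)
    (by simpa using ha)
  rw [intervalIntegrable_iff_integrableOn_Icc_of_le zero_le_one] at h
  exact h

lemma aestronglyMeasurable_pi_restrict {ι : Type*} [Fintype ι] {g : (ι → ℝ) → ℂ}
    (hg : ContinuousOn g (Icc 0 1)) :
    AEStronglyMeasurable g (Measure.pi fun _ : ι => volume.restrict (Icc (0 : ℝ) 1)) := by
  rw [← Measure.restrict_pi_pi, ← volume_pi, Set.pi_univ_Icc]
  exact hg.aestronglyMeasurable measurableSet_Icc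

lemma ae_mem_Icc_pi {ι : Type*} [Fintype ι] :
    ∀ᵐ σ ∂(Measure.pi fun _ : ι => volume.restrict (Icc (0 : ℝ) 1)), σ ∈ Icc (0 : ι → ℝ) 1 := by
  rw [← Measure.restrict_pi_pi, ← volume_pi, Set.pi_univ_Icc]
  exact ae_restrict_mem measurableSet_Icc

section StarShaped

variable {ω : Set ℂ} {f : ℂ → ℂ}

lemma integrable_Hp {ι : Type*} [Fintype ι] {s : ι → ℂ} (hs : ∀ k, (s k).re < 0)
    (hstar : ∀ t ∈ ω, ∀ σ : ℝ, 0 ≤ σ → σ ≤ 1 → (σ : ℂ) * t ∈ ω)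
    (hf : ContinuousOn f ω) {t : ℂ} (ht : t ∈ ω) :
    Integrable (fun σ : ι → ℝ =>
        (∏ k, ((σ k : ℂ) ^ (-(s k) - 1))) * f ((∏ k, ((σ k : ℝ) : ℂ)) * t))
      (Measure.pi fun _ => volume.restrict (Icc (0 : ℝ) 1)) := by
  have hc : ContinuousOn (fun σ : ι → ℝ => f ((∏ k, ((σ k : ℝ) : ℂ)) * t)) (Icc 0 1) := by
    refine hf.comp (by fun_prop) fun σ hσ => ?_
    have := hstar t ht (∏ k, σ k) (Finset.prod_nonneg fun k _ => hσ.1 k)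
      (Finset.prod_le_one (fun k _ => hσ.1 k) fun k _ => hσ.2 k)
    simpa using this
  obtain ⟨M, hM⟩ := isCompact_Icc.exists_bound_of_continuousOn hc
  exact (Integrable.fintype_prod fun k => integrable_cpow_Icc (hs k)).mul_bdd
    (aestronglyMeasurable_pi_restrict hc) (ae_mem_Icc_pi.mono hM)

lemma Hp_fin_succ {n : ℕ} {s : Fin (n + 1) → ℂ} (hs : ∀ k, (s k).re < 0)
    (hstar : ∀ t ∈ ω, ∀ σ : ℝ, 0 ≤ σ → σ ≤ 1 → (σ : ℂ) * t ∈ ω)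
    (hf : ContinuousOn f ω) {t : ℂ} (ht : t ∈ ω) :
    Hp s f t = hOne (s 0) (Hp (fun k => s (Fin.succ k)) f) t := by
  have hmp := (measurePreserving_piFinSuccAbove
    (fun _ : Fin (n + 1) => volume.restrict (Icc (0 : ℝ) 1)) 0).symm
  have hint := integrable_Hp hs hstar hf ht
  rw [Hp_eq_integral_pi, ← hmp.integral_comp', integral_prod]
  · rw [hOne]
    refine integral_congr_ae (Eventually.of_forall fun x => ?_)
    simp only
    rw [Hp_eq_integral_pi, ← integral_const_mul]
    refine integral_congr_ae (Eventually.of_forall fun σ => ?_)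
    simp [Fin.prod_univ_succ, MeasurableEquiv.piFinSuccAbove, Fin.insertNthEquiv]
    ring_nf
  · exact hmp.integrable_comp_of_integrable hint

lemma Hp_insert {ι : Type*} [DecidableEq ι] {s : ι → ℂ} (hs : ∀ k, (s k).re < 0)
    (hstar : ∀ t ∈ ω, ∀ σ : ℝ, 0 ≤ σ → σ ≤ 1 → (σ : ℂ) * t ∈ ω)
    (hf : ContinuousOn f ω) {i : ι} {S : Finset ι} (hi : i ∉ S) {t : ℂ} (ht : t ∈ ω) :
    Hp (fun k : {x // x ∈ insert i S} => s k.1) f t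
      = hOne (s i) (Hp (fun k : {x // x ∈ S} => s k.1) f) t := by
  let e : Fin S.card ≃ {x // x ∈ S} := S.equivFin.symm
  let e' : Fin (S.card + 1) ≃ {x // x ∈ insert i S} :=
    (finSuccEquiv S.card).trans ((Equiv.optionCongr e).trans
      (Finset.subtypeInsertEquivOption hi).symm)
  have h0 : (e' 0).1 = i := by simp [e', Finset.subtypeInsertEquivOption]
  have h1 (k) : (e' (Fin.succ k)).1 = (e k).1 := by
    simp [e', Finset.subtypeInsertEquivOption]
  rw [← Hp_comp_equiv e', Hp_fin_succ (fun k => hs _) hstar hf ht]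
  simp only [h0, h1]
  congr 1
  funext t
  exact Hp_comp_equiv e (fun k => s k.1) f t

lemma hasDerivAt_hOne {a : ℂ} (ha : a.re < 0) (hω : IsOpen ω)
    (hstar : ∀ t ∈ ω, ∀ σ : ℝ, 0 ≤ σ → σ ≤ 1 → (σ : ℂ) * t ∈ ω)
    (hf : DifferentiableOn ℂ f ω) {t : ℂ} (ht : t ∈ ω) :
    Integrable (fun x : ℝ => (x : ℂ) ^ (-a - 1) * (deriv f (x * t) * x))
        (volume.restrict (Icc 0 1)) ∧
      HasDerivAt (hOne a f)
        (∫ x : ℝ in Icc 0 1, (x : ℂ) ^ (-a - 1) * (deriv f (x * t) * x)) t := by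
  have hf' : ContinuousOn (deriv f) ω := (hf.deriv hω).continuousOn
  obtain ⟨ε, hε, hball⟩ := Metric.nhds_basis_closedBall.mem_iff.1 (hω.mem_nhds ht)
  have hmaps : ∀ u ∈ ω, MapsTo (fun x : ℝ => (x : ℂ) * u) (Icc 0 1) ω :=
    fun u hu x hx => hstar u hu x hx.1 hx.2
  have hcf : ∀ u ∈ ω, ContinuousOn (fun x : ℝ => f (x * u)) (Icc 0 1) :=
    fun u hu => hf.continuousOn.comp (by fun_prop) (hmaps u hu)
  have hcf' : ContinuousOn (fun p : ℝ × ℂ => deriv f (p.1 * p.2) * p.1)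
      (Icc 0 1 ×ˢ Metric.closedBall t ε) := by
    refine ContinuousOn.mul (hf'.comp (by fun_prop) fun p hp => ?_) (by fun_prop)
    exact hmaps p.2 (hball hp.2) hp.1
  obtain ⟨M, hM⟩ := (isCompact_Icc.prod (isCompact_closedBall t ε)).exists_bound_of_continuousOn hcf'
  have hint := integrable_cpow_Icc ha
  refine hasDerivAt_integral_of_dominated_loc_of_deriv_le
    (s := Metric.closedBall t ε) (bound := fun x : ℝ => ‖(x : ℂ) ^ (-a - 1)‖ * M)
    (F := fun u (x : ℝ) => (x : ℂ) ^ (-a - 1) * f (x * u))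
    (F' := fun u (x : ℝ) => (x : ℂ) ^ (-a - 1) * (deriv f (x * u) * x))
    (Metric.closedBall_mem_nhds t hε) ?_ ?_ ?_ ?_ (hint.norm.mul_const M) ?_
  · filter_upwards [hω.mem_nhds ht] with u hu
    exact hint.1.mul ((hcf u hu).aestronglyMeasurable measurableSet_Icc)
  · obtain ⟨N, hN⟩ := isCompact_Icc.exists_bound_of_continuousOn (hcf t ht)
    exact hint.mul_bdd ((hcf t ht).aestronglyMeasurable measurableSet_Icc)
      ((ae_restrict_mem measurableSet_Icc).mono hN)
  · refine hint.1.mul (ContinuousOn.aestronglyMeasurable ?_ measurableSet_Icc)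
    exact ContinuousOn.mul (hf'.comp (by fun_prop) (hmaps t ht)) (by fun_prop)
  · filter_upwards [ae_restrict_mem measurableSet_Icc] with x hx u hu
    rw [norm_mul]
    exact mul_le_mul_of_nonneg_left (hM (x, u) ⟨hx, hu⟩) (norm_nonneg _)
  · filter_upwards [ae_restrict_mem measurableSet_Icc] with x hx u hu
    refine HasDerivAt.const_mul _ ?_
    have hd : HasDerivAt f (deriv f (x * u)) (x * u) :=
      (hf.differentiableAt (hω.mem_nhds (hmaps u (hball hu) hx))).hasDerivAt
    exact (hd.comp u ((hasDerivAt_id u).const_mul (x : ℂ))).congr_deriv (by simp)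

lemma eulerOp_hOne {a : ℂ} (ha : a.re < 0) (hω : IsOpen ω)
    (hstar : ∀ t ∈ ω, ∀ σ : ℝ, 0 ≤ σ → σ ≤ 1 → (σ : ℂ) * t ∈ ω)
    (hf : DifferentiableOn ℂ f ω) {t : ℂ} (ht : t ∈ ω) :
    eulerOp (hOne a f) t - a * hOne a f t = f t := by
  obtain ⟨hint', hd⟩ := hasDerivAt_hOne ha hω hstar hf ht
  have hna : 0 < (-a).re := by simpa using ha
  have ha0 : -a ≠ 0 := fun h => by simp [h] at hna
  have hmaps : MapsTo (fun x : ℝ => (x : ℂ) * t) (Icc 0 1) ω :=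
    fun x hx => hstar t ht x hx.1 hx.2
  have hcf : ContinuousOn (fun x : ℝ => f (x * t)) (Icc 0 1) :=
    hf.continuousOn.comp (by fun_prop) hmaps
  have hint : Integrable (fun x : ℝ => (x : ℂ) ^ (-a - 1) * f (x * t))
      (volume.restrict (Icc 0 1)) := by
    obtain ⟨N, hN⟩ := isCompact_Icc.exists_bound_of_continuousOn hcf
    exact (integrable_cpow_Icc ha).mul_bdd (hcf.aestronglyMeasurable measurableSet_Icc)
      ((ae_restrict_mem measurableSet_Icc).mono hN)
  have hsum := (hint'.const_mul t).sub (hint.const_mul a)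
  rw [eulerOp, hd.deriv, hOne, ← integral_const_mul, ← integral_const_mul,
    ← integral_sub (hint'.const_mul t) (hint.const_mul a), integral_Icc_eq_integral_Ioc,
    ← intervalIntegral.integral_of_le zero_le_one,
    intervalIntegral.integral_eq_sub_of_hasDerivAt_of_le
      (f := fun x : ℝ => (x : ℂ) ^ (-a) * f (x * t)) zero_le_one]
  · simp [Complex.zero_cpow ha0]
  · exact (Complex.continuous_ofReal_cpow_const hna).continuousOn.mul hcf
  · intro x hx
    have hx0 : (x : ℂ) ≠ 0 := by exact_mod_cast hx.1.ne'
    have h1 := hasDerivAt_ofReal_cpow_const hx.1.ne' ha0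
    have hfd : HasDerivAt f (deriv f (x * t)) (x * t) :=
      (hf.differentiableAt (hω.mem_nhds (hmaps ⟨hx.1.le, hx.2.le⟩))).hasDerivAt
    have h2 : HasDerivAt (fun y : ℝ => f (y * t)) (deriv f (x * t) * t) x := by
      have h3 : HasDerivAt (fun z : ℂ => f (z * t)) (deriv f (x * t) * t) (x : ℂ) :=
        (hfd.comp (x : ℂ) ((hasDerivAt_id (x : ℂ)).mul_const t)).congr_deriv (by simp)
      exact h3.comp_ofReal
    refine (h1.mul h2).congr_deriv ?_
    have : (x : ℂ) ^ (-a) = (x : ℂ) ^ (-a - 1) * x := by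
      rw [Complex.cpow_sub _ _ hx0, Complex.cpow_one, div_mul_cancel₀ _ hx0]
    rw [this]
    ring
  · rw [intervalIntegrable_iff_integrableOn_Icc_of_le zero_le_one]
    exact hsum

lemma differentiableOn_Hp {ι : Type*} [DecidableEq ι] {s : ι → ℂ} (hs : ∀ k, (s k).re < 0)
    (hω : IsOpen ω) (hstar : ∀ t ∈ ω, ∀ σ : ℝ, 0 ≤ σ → σ ≤ 1 → (σ : ℂ) * t ∈ ω)
    (hf : DifferentiableOn ℂ f ω) (S : Finset ι) :
    DifferentiableOn ℂ (Hp (fun k : {x // x ∈ S} => s k.1) f) ω := by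
  induction S using Finset.induction_on with
  | empty => exact hf.congr fun t _ => Hp_of_isEmpty _ f t
  | insert i S hi ih =>
    have h : DifferentiableOn ℂ (hOne (s i) (Hp (fun k : {x // x ∈ S} => s k.1) f)) ω :=
      fun t ht => (hasDerivAt_hOne (hs i) hω hstar ih ht).2.differentiableAt.differentiableWithinAt
    exact h.congr fun t ht => Hp_insert hs hstar hf.continuousOn hi ht

end StarShaped

section Euler

variable {ω : Set ℂ} {u v : ℂ → ℂ}

lemma eqOn_eulerOp (hω : IsOpen ω) (h : EqOn u v ω) : EqOn (eulerOp u) (eulerOp v) ω :=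
  fun t ht => by
    simp only [eulerOp, (h.eventuallyEq_of_mem (hω.mem_nhds ht)).deriv_eq]

lemma eqOn_iterate_eulerOp (hω : IsOpen ω) (h : EqOn u v ω) (n : ℕ) :
    EqOn (eulerOp^[n] u) (eulerOp^[n] v) ω := by
  induction n generalizing u v with
  | zero => exact h
  | succ n ih => exact ih (eqOn_eulerOp hω h)

lemma differentiableOn_eulerOp (hω : IsOpen ω) (hu : DifferentiableOn ℂ u ω) :
    DifferentiableOn ℂ (eulerOp u) ω :=
  differentiableOn_id.mul (hu.deriv hω)

lemma eqOn_eulerOp_sub_mul (hω : IsOpen ω) (hu : DifferentiableOn ℂ u ω)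
    (hv : DifferentiableOn ℂ v ω) (a : ℂ) :
    EqOn (eulerOp fun z => u z - a * v z) (fun z => eulerOp u z - a * eulerOp v z) ω := by
  intro t ht
  have h1 := (hu.differentiableAt (hω.mem_nhds ht)).hasDerivAt
  have h2 := (hv.differentiableAt (hω.mem_nhds ht)).hasDerivAt
  simp only [eulerOp, (h1.fun_sub (h2.const_mul a)).deriv]
  ring

lemma eqOn_iterate_eulerOp_sub_mul (hω : IsOpen ω) (hu : DifferentiableOn ℂ u ω)
    (hv : DifferentiableOn ℂ v ω) (a : ℂ) (n : ℕ) :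
    EqOn (eulerOp^[n] fun z => u z - a * v z)
      (fun z => eulerOp^[n] u z - a * eulerOp^[n] v z) ω := by
  induction n generalizing u v with
  | zero => exact fun _ _ => rfl
  | succ n ih =>
    exact (eqOn_iterate_eulerOp hω (eqOn_eulerOp_sub_mul hω hu hv a) n).trans
      (ih (differentiableOn_eulerOp hω hu) (differentiableOn_eulerOp hω hv))

lemma polyEuler_eq_sum (q : ℂ[X]) (u : ℂ → ℂ) (t : ℂ) :
    polyEuler q u t = q.sum fun j c => c * (eulerOp^[j] u) t :=
  (q.sum_over_range (f := fun j c => c * (eulerOp^[j] u) t) fun _ => zero_mul _).symm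

lemma polyEuler_add (p q : ℂ[X]) (u : ℂ → ℂ) (t : ℂ) :
    polyEuler (p + q) u t = polyEuler p u t + polyEuler q u t := by
  simp only [polyEuler_eq_sum]
  exact sum_add_index p q _ (fun _ => zero_mul _) fun _ _ _ => add_mul _ _ _

lemma polyEuler_monomial (n : ℕ) (c : ℂ) (u : ℂ → ℂ) (t : ℂ) :
    polyEuler (monomial n c) u t = c * (eulerOp^[n] u) t := by
  rw [polyEuler_eq_sum]
  exact sum_monomial_index c _ (zero_mul _)

lemma eqOn_polyEuler (hω : IsOpen ω) (h : EqOn u v ω) (q : ℂ[X]) :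
    EqOn (polyEuler q u) (polyEuler q v) ω := fun t ht =>
  Finset.sum_congr rfl fun j _ => by rw [eqOn_iterate_eulerOp hω h j ht]

lemma polyEuler_X_sub_C_mul (hω : IsOpen ω) (hu : DifferentiableOn ℂ u ω) (a : ℂ) (q : ℂ[X])
    {t : ℂ} (ht : t ∈ ω) :
    polyEuler ((X - C a) * q) u t = polyEuler q (fun z => eulerOp u z - a * u z) t := by
  induction q using Polynomial.induction_on' with
  | add p q hp hq => rw [mul_add, polyEuler_add, polyEuler_add, hp, hq]
  | monomial n c =>
    have h : (X - C a) * monomial n c = monomial (n + 1) c + monomial n (-(a * c)) := by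
      rw [sub_mul, X_mul_monomial, C_mul_monomial, sub_eq_add_neg, monomial_neg]
    rw [h, polyEuler_add]
    simp only [polyEuler_monomial]
    rw [eqOn_iterate_eulerOp_sub_mul hω (differentiableOn_eulerOp hω hu) hu a n ht,
      Function.iterate_succ_apply]
    ring

end Euler

lemma polyEuler_prod_Hp_union {ι : Type*} [DecidableEq ι] {s : ι → ℂ} (hs : ∀ k, (s k).re < 0)
    {ω : Set ℂ} (hω : IsOpen ω)
    (hstar : ∀ t ∈ ω, ∀ σ : ℝ, 0 ≤ σ → σ ≤ 1 → (σ : ℂ) * t ∈ ω)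
    {f : ℂ → ℂ} (hf : DifferentiableOn ℂ f ω) {S T : Finset ι} (hST : Disjoint S T) :
    EqOn (polyEuler (∏ k ∈ S, (X - C (s k))) (Hp (fun k : {x // x ∈ S ∪ T} => s k.1) f))
      (Hp (fun k : {x // x ∈ T} => s k.1) f) ω := by
  induction S using Finset.induction_on with
  | empty =>
    intro t _
    rw [Finset.prod_empty, ← monomial_zero_one, polyEuler_monomial, Finset.empty_union]
    simp
  | insert i S hi ih =>
    rw [Finset.disjoint_insert_left] at hST
    have hiU : i ∉ S ∪ T := by simp [hi, hST.1]
    have hU := differentiableOn_Hp hs hω hstar hf (S ∪ T)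
    have key : EqOn (fun z => eulerOp (Hp (fun k : {x // x ∈ insert i (S ∪ T)} => s k.1) f) z
        - s i * Hp (fun k : {x // x ∈ insert i (S ∪ T)} => s k.1) f z)
        (Hp (fun k : {x // x ∈ S ∪ T} => s k.1) f) ω := by
      intro z hz
      have hins : EqOn (Hp (fun k : {x // x ∈ insert i (S ∪ T)} => s k.1) f)
          (hOne (s i) (Hp (fun k : {x // x ∈ S ∪ T} => s k.1) f)) ω :=
        fun w hw => Hp_insert hs hstar hf.continuousOn hiU hw
      simp only [eqOn_eulerOp hω hins hz, hins hz]
      exact eulerOp_hOne (hs i) hω hstar hU hz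
    intro t ht
    rw [Finset.prod_insert hi, Finset.insert_union,
      polyEuler_X_sub_C_mul hω (differentiableOn_Hp hs hω hstar hf _) _ _ ht,
      eqOn_polyEuler hω key _ ht, ih hST.2 ht]

theorem statement3 (m : ℕ) (hm : 1 ≤ m) (s : Fin m → ℂ) (hs : ∀ k, (s k).re < 0)
    (ω : Set ℂ) (hω : IsOpen ω)
    (hstar : ∀ t ∈ ω, ∀ σ : ℝ, 0 ≤ σ → σ ≤ 1 → (σ : ℂ) * t ∈ ω)
    (f : ℂ → ℂ) (hf : DifferentiableOn ℂ f ω)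
    (S1 S2 : Finset (Fin m)) (hdisj : Disjoint S1 S2) (hunion : S1 ∪ S2 = Finset.univ) :
    ∀ t ∈ ω,
      polyEuler (∏ k ∈ S1, (X - C (s k))) (Hp s f) t
        = Hp (fun k : {x // x ∈ S2} => s k.1) f t := by
  intro t ht
  have hf' := polyEuler_prod_Hp_union hs hω hstar hf hdisj ht
  rw [hunion] at hf'
  rw [← hf']
  congr 1
  funext z
  exact (Hp_comp_equiv (Equiv.subtypeUnivEquiv Finset.mem_univ) s f z).symm
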